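/- arXiv:2112.12915 — 4 statements merged into one kernel-verified Lean document; each statement's English description precedes it below -/
import Mathlib

section
/- Let γ be a q-cochain (q ≥ 1) of the Schrödinger-Virasoro conformal algebra SV with coefficients in the trivial module ℂ, and let k, l, m ∈ ℤ≥0 with k+l+m = q. Then the polynomial γ_{λ₁,…,λ_q}(L,…,L,Y,…,Y,M,…,M) (k copies of L, then l copies of Y, then m copies of M) is divisible in ℂ[λ₁,…,λ_q] by ∏_{1≤i<j≤k}(λ_i−λ_j) · ∏_{1≤i<j≤l}(λ_{k+i}−λ_{k+j}) · ∏_{1≤i<j≤m}(λ_{k+l+i}−λ_{k+l+j}). In particular, if this component is nonzero, its total degree is at least C(k,2)+C(l,2)+C(m,2). -/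
/-!
Cochain complex of the Schrödinger–Virasoro conformal algebra
`SV = ℂ[∂]L ⊕ ℂ[∂]Y ⊕ ℂ[∂]M` with coefficients in the trivial module `ℂ_a`.

Since `SV` is a free `ℂ[∂]`-module on the generators `L, Y, M`, and since a
`q`-cochain (a `ℂ`-linear, conformally antilinear map `SV^{⊗q} → ℂ[λ₁,…,λ_q]`)
is uniquely determined by its values on `q`-tuples of generators, we model
cochains as functions from generator tuples to `ℂ[λ₁,…,λ_q]`, subject to the
skew-symmetry condition (simultaneous permutation of the entries and the
variables `λᵢ`).
-/

namespace SVCA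

open MvPolynomial

/-- The generators `L`, `Y`, `M` of the Schrödinger–Virasoro conformal algebra. -/
inductive SVGen : Type
  | L | Y | M
  deriving DecidableEq

open SVGen

/-- The λ-brackets on generators: `SVbrk a b = (x, c₁, c₂)` encodes
`[a_λ b] = (c₁ ∂ + c₂ λ) x`.  Zero brackets are encoded by zero coefficients:
`[L_λ L] = (∂+2λ)L`, `[L_λ Y] = (∂+(3/2)λ)Y`, `[Y_λ L] = ((1/2)∂+(3/2)λ)Y`,
`[Y_λ Y] = (∂+2λ)M`, `[L_λ M] = (∂+λ)M`, `[M_λ L] = λM`, and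
`[Y_λ M] = [M_λ Y] = [M_λ M] = 0`. -/
noncomputable def SVbrk : SVGen → SVGen → SVGen × ℂ × ℂ
  | L, L => (L, 1, 2)
  | L, Y => (Y, 1, 3/2)
  | Y, L => (Y, 1/2, 3/2)
  | Y, Y => (M, 1, 2)
  | L, M => (M, 1, 1)
  | M, L => (M, 0, 1)
  | _, _ => (M, 0, 0)

/-- The space of (not necessarily skew-symmetric) `q`-cochains with trivial
coefficients: functions from `q`-tuples of generators to `ℂ[λ₁,…,λ_q]`. -/
abbrev SVRaw (q : ℕ) := (Fin q → SVGen) → MvPolynomial (Fin q) ℂ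

/-- The `ℂ`-subspace `C̃^q(SV,ℂ)` of `q`-cochains: skew-symmetry with respect to
simultaneous permutations of the arguments and of the variables `λᵢ`. -/
noncomputable def SVCochain (q : ℕ) : Submodule ℂ (SVRaw q) where
  carrier := {c | ∀ (σ : Equiv.Perm (Fin q)) (a : Fin q → SVGen),
      rename σ (c (a ∘ σ)) = ((Equiv.Perm.sign σ : ℤ) : ℂ) • c a}
  add_mem' := by
    intro c c' hc hc' σ a
    simp only [Pi.add_apply, map_add, hc σ a, hc' σ a, smul_add]
  zero_mem' := by intro σ a; simp
  smul_mem' := by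
    intro r c hc σ a
    simp only [Pi.smul_apply, map_smul, hc σ a]
    rw [smul_comm]

/-- The strictly increasing embedding `Fin q → Fin (q+2)` omitting `i` and `j`
(meaningful for `i < j`; junk otherwise). -/
def SVskip {q : ℕ} (i j : Fin (q + 2)) (k : Fin q) : Fin (q + 2) :=
  j.succAbove ((⟨min (i : ℕ) q, Nat.lt_succ_of_le (Nat.min_le_right _ _)⟩ : Fin (q + 1)).succAbove k)

/-- The `(i,j)`-summand of the differential (trivial coefficients):
`(-1)^{i+j} γ_{λᵢ+λⱼ, λ₁, …, λ̂ᵢ, …, λ̂ⱼ, …}([a_{i λᵢ} a_j], a₁, …, âᵢ, …, âⱼ, …)`,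
where `[a_{i λᵢ} a_j] = (c₁∂ + c₂λᵢ)x` and conformal antilinearity in the first
slot (whose variable is `λᵢ+λⱼ`) produces the factor `c₂λᵢ - c₁(λᵢ+λⱼ)`. -/
noncomputable def SVdTerm {q : ℕ} (c : SVRaw (q + 1)) (a : Fin (q + 2) → SVGen)
    (i j : Fin (q + 2)) : MvPolynomial (Fin (q + 2)) ℂ :=
  ((-1 : ℂ) ^ ((i : ℕ) + (j : ℕ))) •
    ((C (SVbrk (a i) (a j)).2.2 * X i - C (SVbrk (a i) (a j)).2.1 * (X i + X j)) *
      aeval (Fin.cons (X i + X j) fun k => X (SVskip i j k))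
        (c (Fin.cons (SVbrk (a i) (a j)).1 fun k => a (SVskip i j k))))

/-- The differential `d_q : C̃^q → C̃^{q+1}` (trivial coefficients). -/
noncomputable def SVd : {q : ℕ} → SVRaw q → SVRaw (q + 1)
  | 0, _ => 0
  | (q + 1), c => fun a =>
      ∑ i : Fin (q + 2), ∑ j : Fin (q + 2),
        if (i : ℕ) < (j : ℕ) then SVdTerm c a i j else 0

lemma SVdTerm_add {q : ℕ} (c c' : SVRaw (q + 1)) (a : Fin (q + 2) → SVGen)
    (i j : Fin (q + 2)) :
    SVdTerm (c + c') a i j = SVdTerm c a i j + SVdTerm c' a i j := by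
  simp [SVdTerm, mul_add, smul_add]

lemma SVdTerm_smul {q : ℕ} (r : ℂ) (c : SVRaw (q + 1)) (a : Fin (q + 2) → SVGen)
    (i j : Fin (q + 2)) :
    SVdTerm (r • c) a i j = r • SVdTerm c a i j := by
  simp only [SVdTerm, Pi.smul_apply, map_smul, mul_smul_comm]
  rw [smul_comm]

/-- The differential as a `ℂ`-linear map. -/
noncomputable def SVdLin (q : ℕ) : SVRaw q →ₗ[ℂ] SVRaw (q + 1) where
  toFun := SVd
  map_add' c c' := by
    cases q with
    | zero => simp [SVd]
    | succ q =>
      funext a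
      simp only [SVd, Pi.add_apply]
      rw [← Finset.sum_add_distrib]
      refine Finset.sum_congr rfl fun i _ => ?_
      rw [← Finset.sum_add_distrib]
      refine Finset.sum_congr rfl fun j _ => ?_
      by_cases h : (i : ℕ) < (j : ℕ)
      · simp [h, SVdTerm_add]
      · simp [h]
  map_smul' r c := by
    cases q with
    | zero => simp [SVd]
    | succ q =>
      funext a
      simp only [SVd, RingHom.id_apply, Pi.smul_apply, Finset.smul_sum]
      refine Finset.sum_congr rfl fun i _ => ?_
      refine Finset.sum_congr rfl fun j _ => ?_
      by_cases h : (i : ℕ) < (j : ℕ)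
      · simp [h, SVdTerm_smul]
      · simp [h]

/-- The space `D̃^q(SV,ℂ)` of `q`-cocycles: skew-symmetric cochains with `dγ = 0`. -/
noncomputable def SVcocycles (q : ℕ) : Submodule ℂ (SVRaw q) :=
  SVCochain q ⊓ LinearMap.ker (SVdLin q)

/-- The space `B̃^q(SV,ℂ)` of `q`-coboundaries: differentials of `(q-1)`-cochains
(`0` for `q = 0`). -/
noncomputable def SVcoboundaries : (q : ℕ) → Submodule ℂ (SVRaw q)
  | 0 => ⊥
  | (q + 1) => Submodule.map (SVdLin q) (SVCochain q)

/-- The basic cohomology `H̃^q(SV,ℂ)` = cocycles / coboundaries. -/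
noncomputable def SVbasicH (q : ℕ) :=
  SVcocycles q ⧸ Submodule.comap (SVcocycles q).subtype (SVcoboundaries q)


noncomputable instance (q : ℕ) : AddCommGroup (SVbasicH q) := by
  unfold SVbasicH; infer_instance
noncomputable instance (q : ℕ) : Module ℂ (SVbasicH q) := by
  unfold SVbasicH; infer_instance

/-- The action of `∂` on `q`-cochains with coefficients in `ℂ_a`:
`(∂γ)_{λ₁,…,λ_q} = (a + λ₁ + ⋯ + λ_q)·γ_{λ₁,…,λ_q}`.  (The trivial module `ℂ`
is the case `a = 0`.) -/
noncomputable def SVpartial (a : ℂ) (q : ℕ) : SVRaw q →ₗ[ℂ] SVRaw q where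
  toFun c := fun t => (C a + ∑ i, X i) * c t
  map_add' c c' := by funext t; simp [mul_add]
  map_smul' r c := by funext t; simp [mul_smul_comm]

/-- The subspace `∂C̃^q ⊆ C̃^q` (with coefficients in `ℂ_a`). -/
noncomputable def SVpartialSub (a : ℂ) (q : ℕ) : Submodule ℂ (SVRaw q) :=
  Submodule.map (SVpartial a q) (SVCochain q)

/-- `q`-cochains representing reduced `q`-cocycles: cochains `γ` with
`dγ ∈ ∂C̃^{q+1}` (these are exactly the representatives of `ker d̄`
in the quotient complex `C̃^•/∂C̃^•`). -/
noncomputable def SVredCocycles (a : ℂ) (q : ℕ) : Submodule ℂ (SVRaw q) :=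
  SVCochain q ⊓ Submodule.comap (SVdLin q) (SVpartialSub a (q + 1))

/-- `q`-cochains representing reduced `q`-coboundaries: `∂C̃^q + dC̃^{q-1}`
(these are exactly the representatives of `im d̄` in the quotient complex). -/
noncomputable def SVredCoboundaries (a : ℂ) : (q : ℕ) → Submodule ℂ (SVRaw q)
  | 0 => SVpartialSub a 0
  | (q + 1) => SVpartialSub a (q + 1) ⊔ Submodule.map (SVdLin q) (SVCochain q)

/-- The reduced cohomology `H^q(SV,ℂ_a)`, realized (via the third isomorphism
theorem) as `{γ ∈ C̃^q : dγ ∈ ∂C̃^{q+1}} / (∂C̃^q + dC̃^{q-1})`. -/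
noncomputable def SVredH (a : ℂ) (q : ℕ) :=
  SVredCocycles a q ⧸ Submodule.comap (SVredCocycles a q).subtype (SVredCoboundaries a q)


noncomputable instance (a : ℂ) (q : ℕ) : AddCommGroup (SVredH a q) := by
  unfold SVredH; infer_instance
noncomputable instance (a : ℂ) (q : ℕ) : Module ℂ (SVredH a q) := by
  unfold SVredH; infer_instance

/-- The cocycles of the subcomplex `∂C̃^•` (trivial coefficients `ℂ`). -/
noncomputable def SVsubCocycles (q : ℕ) : Submodule ℂ (SVRaw q) :=
  SVpartialSub 0 q ⊓ LinearMap.ker (SVdLin q)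

/-- The coboundaries of the subcomplex `∂C̃^•` (trivial coefficients `ℂ`). -/
noncomputable def SVsubCoboundaries : (q : ℕ) → Submodule ℂ (SVRaw q)
  | 0 => ⊥
  | (q + 1) => Submodule.map (SVdLin q) (SVpartialSub 0 q)

/-- The cohomology `H^q(∂C̃^•)` of the subcomplex `∂C̃^•` (trivial coefficients). -/
noncomputable def SVsubH (q : ℕ) :=
  SVsubCocycles q ⧸ Submodule.comap (SVsubCocycles q).subtype (SVsubCoboundaries q)


noncomputable instance (q : ℕ) : AddCommGroup (SVsubH q) := by
  unfold SVsubH; infer_instance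
noncomputable instance (q : ℕ) : Module ℂ (SVsubH q) := by
  unfold SVsubH; infer_instance

/-- The operator `τ`:
`(τγ)_{λ₁,…,λ_{q-1}}(a₁,…,a_{q-1}) = (-1)^{q-1} ∂/∂λ γ_{λ₁,…,λ_{q-1},λ}(a₁,…,a_{q-1},L)|_{λ=0}`. -/
noncomputable def SVtau {q : ℕ} (c : SVRaw (q + 1)) : SVRaw q := fun a =>
  ((-1 : ℂ) ^ q) •
    aeval (Fin.snoc (fun i : Fin q => X i) 0)
      (pderiv (Fin.last q) (c (Fin.snoc a SVGen.L)))

/-- The operator `τ₂`: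
`(τ₂γ)_{λ₁,…,λ_{q-1}}(a₁,…,a_{q-1}) = (-1)^{q-1} γ_{λ₁,…,λ_{q-1},λ}(a₁,…,a_{q-1},L)|_{λ=0}`. -/
noncomputable def SVtau2 {q : ℕ} (c : SVRaw (q + 1)) : SVRaw q := fun a =>
  ((-1 : ℂ) ^ q) • aeval (Fin.snoc (fun i : Fin q => X i) 0) (c (Fin.snoc a SVGen.L))

/-- The tuple with `k` copies of `L`, then `l` copies of `Y`, then copies of `M`. -/
def SVtuple (q k l : ℕ) : Fin q → SVGen := fun i =>
  if (i : ℕ) < k then SVGen.L else if (i : ℕ) < k + l then SVGen.Y else SVGen.M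

/-- `∏_{i<j ∈ s} (λᵢ - λⱼ)`. -/
noncomputable def SVvandermonde (q : ℕ) (s : Finset (Fin q)) : MvPolynomial (Fin q) ℂ :=
  ∏ p ∈ (s ×ˢ s).filter fun p => p.1 < p.2, (X p.1 - X p.2)

/-- Exchanging `X i` for `X j` changes a polynomial by a multiple of `X i - X j`. -/
lemma X_sub_X_dvd_sub_aeval_update {R σ : Type*} [CommRing R] [DecidableEq σ] (i j : σ)
    (p : MvPolynomial σ R) :
    X i - X j ∣ p - aeval (Function.update X i (X j : MvPolynomial σ R)) p := by
  rw [← Ideal.mem_span_singleton, ← Ideal.Quotient.mk_eq_mk_iff_sub_mem]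
  set I : Ideal (MvPolynomial σ R) := Ideal.span {X i - X j}
  have h : Ideal.Quotient.mkₐ R I =
      (Ideal.Quotient.mkₐ R I).comp (aeval (Function.update X i (X j))) := by
    refine algHom_ext fun v => ?_
    rcases eq_or_ne v i with rfl | hv
    · simpa [I] using Ideal.Quotient.mk_eq_mk_iff_sub_mem (X v) (X j) |>.2
        (Ideal.mem_span_singleton_self _)
    · simp [hv]
  exact DFunLike.congr_fun h p

/-- A polynomial that is antisymmetric in two variables is divisible by their difference. -/
lemma X_sub_X_dvd_of_rename_swap_eq_neg {R σ : Type*} [CommRing R] [IsDomain R] [CharZero R]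
    [DecidableEq σ] {i j : σ} {p : MvPolynomial σ R}
    (hp : rename (Equiv.swap i j) p = -p) : X i - X j ∣ p := by
  have hcomp : (Function.update X i (X j) : σ → MvPolynomial σ R) ∘ Equiv.swap i j =
      Function.update X i (X j) := by
    funext v
    simp only [Function.comp_apply, Function.update_apply, Equiv.swap_apply_def]
    grind
  have h := congrArg (aeval (Function.update X i (X j : MvPolynomial σ R))) hp
  rw [aeval_rename, hcomp, map_neg, self_eq_neg] at h
  simpa only [h, sub_zero] using X_sub_X_dvd_sub_aeval_update i j p

lemma irreducible_X_sub_X {K σ : Type*} [Field K] {i j : σ} (hij : i ≠ j) :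
    Irreducible (X i - X j : MvPolynomial σ K) := by
  have hne : (X i - X j : MvPolynomial σ K) ≠ 0 := sub_ne_zero.2 fun h => hij (X_injective h)
  refine irreducible_of_totalDegree_eq_one
    (((isHomogeneous_X K i).sub (isHomogeneous_X K j)).totalDegree hne) fun x hx => ?_
  obtain ⟨d, hd⟩ := ne_zero_iff.1 hne
  exact (ne_zero_of_dvd_ne_zero hd (hx d)).isUnit

lemma isRelPrime_X_sub_X {K σ : Type*} [Field K] [LinearOrder σ] {p r : σ × σ}
    (hp : p.1 < p.2) (hr : r.1 < r.2) (hpr : p ≠ r) :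
    IsRelPrime (X p.1 - X p.2 : MvPolynomial σ K) (X r.1 - X r.2) := by
  rw [(irreducible_X_sub_X hp.ne).isRelPrime_iff_not_dvd]
  rintro ⟨g, hg⟩
  have h := congrArg (rename fun v => if v = p.1 then p.2 else v) hg
  simp only [map_mul, map_sub, rename_X, if_true, if_neg hp.ne', sub_self, zero_mul] at h
  have h' := X_injective (sub_eq_zero.1 h)
  apply hpr
  ext <;> grind

lemma isRelPrime_SVvandermonde {q : ℕ} {s t : Finset (Fin q)} (hst : Disjoint s t) :
    IsRelPrime (SVvandermonde q s) (SVvandermonde q t) := by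
  refine IsRelPrime.prod_left fun p hp => IsRelPrime.prod_right fun r hr => ?_
  simp only [Finset.mem_filter, Finset.mem_product] at hp hr
  refine isRelPrime_X_sub_X hp.2 hr.2 ?_
  rintro rfl
  exact Finset.disjoint_left.1 hst hp.1.1 hr.1.1

lemma isHomogeneous_SVvandermonde (q : ℕ) (s : Finset (Fin q)) :
    (SVvandermonde q s).IsHomogeneous (s.card.choose 2) := by
  have h := IsHomogeneous.prod ((s ×ˢ s).filter fun p => p.1 < p.2)
    (fun p => (X p.1 - X p.2 : MvPolynomial (Fin q) ℂ)) (fun _ => 1)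
    fun p _ => (isHomogeneous_X ℂ p.1).sub (isHomogeneous_X ℂ p.2)
  rwa [← Finset.card_eq_sum_ones, Finset.card_product_filter_lt] at h

/-- A cochain component is divisible by the Vandermonde product of any set of slots
carrying the same generator. -/
lemma SVvandermonde_dvd {q : ℕ} {γ : SVRaw q} (hγ : γ ∈ SVCochain q) {a : Fin q → SVGen}
    {s : Finset (Fin q)} (hs : ∀ i ∈ s, ∀ j ∈ s, a i = a j) :
    SVvandermonde q s ∣ γ a := by
  refine Finset.prod_dvd_of_isRelPrime (fun p hp r hr hpr => ?_) fun p hp => ?_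
  · exact isRelPrime_X_sub_X (Finset.mem_filter.1 hp).2 (Finset.mem_filter.1 hr).2 hpr
  · simp only [Finset.mem_filter, Finset.mem_product] at hp
    have ha : a ∘ Equiv.swap p.1 p.2 = a := by
      funext v
      simp only [Function.comp_apply, Equiv.swap_apply_def]
      grind
    have h := hγ (Equiv.swap p.1 p.2) a
    rw [ha, Equiv.Perm.sign_swap hp.2.ne] at h
    exact X_sub_X_dvd_of_rename_swap_eq_neg (by simpa using h)

lemma card_filter_val_mem_Ico {q b c : ℕ} (hc : c ≤ q) {P : Fin q → Prop} [DecidablePred P]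
    (hP : ∀ i, P i ↔ b ≤ (i : ℕ) ∧ (i : ℕ) < c) :
    (Finset.univ.filter P).card = c - b := by
  rw [← Nat.card_Ico, ← Finset.card_map Fin.valEmbedding]
  congr 1
  ext n
  simp only [Finset.mem_map, Finset.mem_filter, Finset.mem_univ, true_and, hP,
    Fin.valEmbedding_apply, Finset.mem_Ico]
  exact ⟨by rintro ⟨i, hi, rfl⟩; exact hi, fun hn => ⟨⟨n, by omega⟩, hn, rfl⟩⟩

/-- For a `q`-cochain `γ` (`q ≥ 1`) and `k + l + m = q`, the
component `γ_{λ₁,…,λ_q}(L,…,L,Y,…,Y,M,…,M)` (with `k` copies of `L`, `l` copies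
of `Y`, `m` copies of `M`) is divisible by
`∏_{1≤i<j≤k}(λᵢ-λⱼ) ∏_{1≤i<j≤l}(λ_{k+i}-λ_{k+j}) ∏_{1≤i<j≤m}(λ_{k+l+i}-λ_{k+l+j})`;
in particular, when nonzero its total degree is at least
`C(k,2)+C(l,2)+C(m,2)`. -/
theorem statement1 (q : ℕ) (hq : 1 ≤ q) (γ : SVRaw q) (hγ : γ ∈ SVCochain q)
    (k l m : ℕ) (hklm : k + l + m = q) :
    (SVvandermonde q (Finset.univ.filter fun i => (i : ℕ) < k) *
        SVvandermonde q (Finset.univ.filter fun i => k ≤ (i : ℕ) ∧ (i : ℕ) < k + l) *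
        SVvandermonde q (Finset.univ.filter fun i => k + l ≤ (i : ℕ))) ∣
      γ (SVtuple q k l) ∧
    (γ (SVtuple q k l) ≠ 0 →
      Nat.choose k 2 + Nat.choose l 2 + Nat.choose m 2 ≤ (γ (SVtuple q k l)).totalDegree) := by
  have hdvd : SVvandermonde q (Finset.univ.filter fun i => (i : ℕ) < k) *
        SVvandermonde q (Finset.univ.filter fun i => k ≤ (i : ℕ) ∧ (i : ℕ) < k + l) *
        SVvandermonde q (Finset.univ.filter fun i => k + l ≤ (i : ℕ)) ∣
      γ (SVtuple q k l) := by
    refine IsRelPrime.mul_dvd (IsRelPrime.mul_left ?_ ?_) (IsRelPrime.mul_dvd ?_ ?_ ?_) ?_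
    any_goals
      refine isRelPrime_SVvandermonde (Finset.disjoint_filter.2 fun i _ _ => ?_)
      omega
    all_goals
      refine SVvandermonde_dvd hγ fun i hi j hj => ?_
      simp only [Finset.mem_filter, Finset.mem_univ, true_and] at hi hj
      grind [SVtuple]
  refine ⟨hdvd, fun hne => ?_⟩
  have hhom := ((isHomogeneous_SVvandermonde q (Finset.univ.filter fun i => (i : ℕ) < k)).mul
    (isHomogeneous_SVvandermonde q
      (Finset.univ.filter fun i => k ≤ (i : ℕ) ∧ (i : ℕ) < k + l))).mul
    (isHomogeneous_SVvandermonde q (Finset.univ.filter fun i => k + l ≤ (i : ℕ)))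
  have hdeg := totalDegree_le_of_dvd_of_isDomain hdvd hne
  rw [hhom.totalDegree (ne_zero_of_dvd_ne_zero hne hdvd),
    card_filter_val_mem_Ico (b := 0) (c := k) (by omega) (by simp),
    card_filter_val_mem_Ico (b := k) (c := k + l) (by omega) (by simp),
    card_filter_val_mem_Ico (b := k + l) (c := q) le_rfl (by simp)] at hdeg
  convert hdeg using 4 <;> omega

end SVCA
end

section
/- Define the operator τ from q-cochains to (q−1)-cochains of SV with trivial coefficients ℂ by (τγ)_{λ₁,…,λ_{q−1}}(a₁,…,a_{q−1}) = (−1)^{q−1} (∂/∂λ) γ_{λ₁,…,λ_{q−1},λ}(a₁,…,a_{q−1},L) |_{λ=0}. If γ is a q-cochain whose component γ_{λ₁,…,λ_q}(L,…,L,Y,…,Y,M,…,M) (k copies of L, l of Y, m of M, k+l+m = q) is a homogeneous polynomial of total degree n, then on that component ((dτ + τd)γ) = (n − k − l/2)·γ. Consequently, every q-cocycle each of whose components is homogeneous of degree n_{(k,l,m)} ≠ k + l/2 is a coboundary, so only homogeneous cochains whose degree on the (k,l,m)-component equals k + l/2 can contribute to H̃^q(SV,ℂ). -/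
/-!
Cochain complex of the Schrödinger–Virasoro conformal algebra
`SV = ℂ[∂]L ⊕ ℂ[∂]Y ⊕ ℂ[∂]M` with coefficients in the trivial module `ℂ_a`.

Since `SV` is a free `ℂ[∂]`-module on the generators `L, Y, M`, and since a
`q`-cochain (a `ℂ`-linear, conformally antilinear map `SV^{⊗q} → ℂ[λ₁,…,λ_q]`)
is uniquely determined by its values on `q`-tuples of generators, we model
cochains as functions from generator tuples to `ℂ[λ₁,…,λ_q]`, subject to the
skew-symmetry condition (simultaneous permutation of the entries and the
variables `λᵢ`).
-/

namespace SVCA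

open MvPolynomial

open SVGen

/-- The weight of a generator: `1` for `L`, `1/2` for `Y` and `0` for `M`. -/
noncomputable def SVweight : SVGen → ℂ
  | L => 1
  | Y => 1 / 2
  | M => 0

/-- The Euler derivation `∑ᵢ λᵢ ∂/∂λᵢ`. -/
noncomputable def eulerDerivation (σ : Type*) :
    Derivation ℂ (MvPolynomial σ ℂ) (MvPolynomial σ ℂ) :=
  mkDerivation ℂ X

@[simp] lemma eulerDerivation_X {σ : Type*} (i : σ) :
    eulerDerivation σ (X i) = X i :=
  mkDerivation_X _ _ _

@[simp] lemma eulerDerivation_C {σ : Type*} (r : ℂ) :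
    eulerDerivation σ (C r) = 0 :=
  derivation_C _ _

lemma eulerDerivation_eq_sum {σ : Type*} [Fintype σ] (p : MvPolynomial σ ℂ) :
    eulerDerivation σ p = ∑ i, X i * pderiv i p := by
  classical
  induction p using MvPolynomial.induction_on with
  | C r => simp
  | add p q hp hq => simp [hp, hq, mul_add, Finset.sum_add_distrib]
  | mul_X p j hp =>
    simp only [Derivation.leibniz, hp, eulerDerivation_X, pderiv_X, smul_eq_mul, mul_add,
      Finset.sum_add_distrib, Finset.mul_sum]
    congr 1
    · simp [Pi.single_apply, mul_comm]
    · exact Finset.sum_congr rfl fun i _ => mul_left_comm _ _ _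

lemma eulerDerivation_aeval {σ τ : Type*} (f : σ → MvPolynomial τ ℂ)
    (hf : ∀ i, eulerDerivation τ (f i) = f i) (p : MvPolynomial σ ℂ) :
    eulerDerivation τ (aeval f p) = aeval f (eulerDerivation σ p) := by
  induction p using MvPolynomial.induction_on with
  | C r => simp [algebraMap_eq]
  | add p q hp hq => simp only [map_add, hp, hq]
  | mul_X p i hp => simp [Derivation.leibniz, hp, hf, -aeval_eq_bind₁]

lemma eulerDerivation_rename {σ τ : Type*} (f : σ → τ) (p : MvPolynomial σ ℂ) :
    eulerDerivation τ (rename f p) = rename f (eulerDerivation σ p) := by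
  rw [rename_eq_aeval]
  exact eulerDerivation_aeval _ (fun i => eulerDerivation_X (f i)) p

/-- The degree operator on cochains: the Euler derivation minus the total weight of the
arguments. -/
noncomputable def SVeuler (q : ℕ) : Module.End ℂ (SVRaw q) where
  toFun c := fun a => eulerDerivation _ (c a) - (∑ i, SVweight (a i)) • c a
  map_add' c c' := by
    funext a
    simp only [Pi.add_apply, map_add, smul_add]
    abel
  map_smul' r c := by
    funext a
    simp only [Pi.smul_apply, Derivation.map_smul, RingHom.id_apply, smul_sub]
    rw [smul_comm]

lemma SVeuler_apply {q : ℕ} (c : SVRaw q) (a : Fin q → SVGen) :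
    SVeuler q c a = eulerDerivation _ (c a) - (∑ i, SVweight (a i)) • c a :=
  rfl

lemma SVeuler_apply_of_isHomogeneous {q n : ℕ} {c : SVRaw q} {a : Fin q → SVGen}
    (h : (c a).IsHomogeneous n) :
    SVeuler q c a = ((n : ℂ) - ∑ i, SVweight (a i)) • c a := by
  rw [SVeuler_apply, eulerDerivation_eq_sum, h.sum_X_mul_pderiv, sub_smul, Nat.cast_smul_eq_nsmul]

lemma SVeuler_mem_SVCochain {q : ℕ} {c : SVRaw q} (hc : c ∈ SVCochain q) :
    SVeuler q c ∈ SVCochain q := by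
  intro σ a
  rw [SVeuler_apply, SVeuler_apply, map_sub, map_smul, ← eulerDerivation_rename, hc σ a,
    Derivation.map_smul, smul_sub, smul_comm]
  simp only [Function.comp_apply, Equiv.sum_comp σ fun i => SVweight (a i)]

lemma succAbove_min_of_lt {q : ℕ} {i j : Fin (q + 2)} (h : (i : ℕ) < j) :
    j.succAbove ⟨min (i : ℕ) q, Nat.lt_succ_of_le (Nat.min_le_right _ _)⟩ = i := by
  apply Fin.ext
  simp only [Fin.succAbove, Fin.lt_def, Fin.val_castSucc]
  split_ifs <;> simp only [Fin.val_castSucc, Fin.val_succ] <;> omega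

lemma sum_eq_add_add_sum_SVskip {q : ℕ} {i j : Fin (q + 2)} (h : (i : ℕ) < j)
    (f : Fin (q + 2) → ℂ) : ∑ k, f k = f i + f j + ∑ k, f (SVskip i j k) := by
  rw [Fin.sum_univ_succAbove f j, Fin.sum_univ_succAbove _
    ⟨min (i : ℕ) q, Nat.lt_succ_of_le (Nat.min_le_right _ _)⟩, succAbove_min_of_lt h]
  simp only [SVskip]
  ring

/-- A nonzero bracket `[a_λ b]` has weight `w(a) + w(b) - 1`. -/
lemma SVweight_SVbrk (a b : SVGen) :
    SVweight (SVbrk a b).1 = SVweight a + SVweight b - 1 ∨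
      (SVbrk a b).2.1 = 0 ∧ (SVbrk a b).2.2 = 0 := by
  cases a <;> cases b <;> norm_num [SVbrk, SVweight]

lemma SVdTerm_SVeuler {q : ℕ} (c : SVRaw (q + 1)) (a : Fin (q + 2) → SVGen)
    {i j : Fin (q + 2)} (h : (i : ℕ) < j) :
    SVdTerm (SVeuler _ c) a i j =
      eulerDerivation _ (SVdTerm c a i j) - (∑ k, SVweight (a k)) • SVdTerm c a i j := by
  rcases SVweight_SVbrk (a i) (a j) with hw | ⟨h₁, h₂⟩
  · have hf : ∀ k, eulerDerivation _ ((Fin.cons (X i + X j) fun k => X (SVskip i j k) :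
        Fin (q + 1) → MvPolynomial (Fin (q + 2)) ℂ) k) =
        (Fin.cons (X i + X j) fun k => X (SVskip i j k) :
        Fin (q + 1) → MvPolynomial (Fin (q + 2)) ℂ) k := by
      intro k
      refine Fin.cases ?_ (fun k => ?_) k <;> simp
    simp only [SVdTerm, SVeuler_apply, Derivation.map_smul, Derivation.leibniz, map_sub, map_smul,
      map_add, eulerDerivation_aeval _ hf, eulerDerivation_X, eulerDerivation_C,
      sum_eq_add_add_sum_SVskip h fun k => SVweight (a k), Fin.sum_univ_succ, Fin.cons_zero,
      Fin.cons_succ, hw, add_smul, sub_smul, one_smul]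
    simp only [smul_eq_C_mul, smul_eq_mul]
    ring
  · simp [SVdTerm, h₁, h₂]

lemma SVd_SVeuler {q : ℕ} (c : SVRaw q) : SVd (SVeuler q c) = SVeuler (q + 1) (SVd c) := by
  cases q with
  | zero => simp [SVd]
  | succ q =>
    funext a
    simp only [SVd, SVeuler_apply, map_sum, Finset.smul_sum, ← Finset.sum_sub_distrib]
    refine Finset.sum_congr rfl fun i _ => Finset.sum_congr rfl fun j _ => ?_
    split_ifs with h
    · exact SVdTerm_SVeuler c a h
    · simp

lemma SVcocycles_le_comap_SVeuler (q : ℕ) :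
    SVcocycles q ≤ (SVcocycles q).comap (SVeuler q) := by
  rintro c ⟨hc, hd⟩
  refine ⟨SVeuler_mem_SVCochain hc, ?_⟩
  have hd' : SVd c = 0 := hd
  change SVd (SVeuler q c) = 0
  rw [SVd_SVeuler, hd', map_zero]

/-- Setting the last variable to zero. -/
noncomputable def evalLast (q : ℕ) :
    MvPolynomial (Fin (q + 1)) ℂ →ₐ[ℂ] MvPolynomial (Fin q) ℂ :=
  aeval (Fin.snoc (fun i : Fin q => X i) 0)

@[simp] lemma evalLast_X_castSucc {q : ℕ} (i : Fin q) : evalLast q (X i.castSucc) = X i := by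
  simp [evalLast]

@[simp] lemma evalLast_X_last {q : ℕ} : evalLast q (X (Fin.last q)) = 0 := by
  simp [evalLast]

@[simp] lemma evalLast_C {q : ℕ} (r : ℂ) : evalLast q (C r) = C r :=
  (evalLast q).commutes r

/-- The coefficient of the first power of the last variable. -/
noncomputable def coeffLast (q : ℕ) :
    MvPolynomial (Fin (q + 1)) ℂ →ₗ[ℂ] MvPolynomial (Fin q) ℂ :=
  (evalLast q).toLinearMap ∘ₗ (pderiv (Fin.last q)).toLinearMap

lemma coeffLast_apply {q : ℕ} (p : MvPolynomial (Fin (q + 1)) ℂ) :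
    coeffLast q p = evalLast q (pderiv (Fin.last q) p) :=
  rfl

@[simp] lemma coeffLast_mul {q : ℕ} (p r : MvPolynomial (Fin (q + 1)) ℂ) :
    coeffLast q (p * r) = coeffLast q p * evalLast q r + evalLast q p * coeffLast q r := by
  simp only [coeffLast_apply, pderiv_mul, map_add, map_mul]

@[simp] lemma coeffLast_X_castSucc {q : ℕ} (i : Fin q) : coeffLast q (X i.castSucc) = 0 := by
  rw [coeffLast_apply, pderiv_X_of_ne (Fin.castSucc_lt_last i).ne, map_zero]

@[simp] lemma coeffLast_X_last {q : ℕ} : coeffLast q (X (Fin.last q)) = 1 := by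
  simp [coeffLast_apply]

@[simp] lemma coeffLast_C {q : ℕ} (r : ℂ) : coeffLast q (C r) = 0 := by
  simp [coeffLast_apply]

lemma SVtau_apply {q : ℕ} (c : SVRaw (q + 1)) (a : Fin q → SVGen) :
    SVtau c a = ((-1 : ℂ) ^ q) • coeffLast q (c (Fin.snoc a L)) :=
  rfl

section Substitution

variable {n m : ℕ} {F : Fin (n + 1) → MvPolynomial (Fin (m + 1)) ℂ}
  {G : Fin n → MvPolynomial (Fin m) ℂ}

lemma evalLast_aeval (h : ∀ k, evalLast m (F k.castSucc) = G k)
    (hl : evalLast m (F (Fin.last n)) = 0) (p : MvPolynomial (Fin (n + 1)) ℂ) :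
    evalLast m (aeval F p) = aeval G (evalLast n p) := by
  induction p using MvPolynomial.induction_on with
  | C r => simp [algebraMap_eq]
  | add p q hp hq => simp only [map_add, hp, hq]
  | mul_X p i hp =>
    refine Fin.lastCases ?_ (fun i => ?_) i <;> simp [-aeval_eq_bind₁, hp, h, hl]

lemma coeffLast_aeval (h : ∀ k, evalLast m (F k.castSucc) = G k)
    (h' : ∀ k : Fin n, coeffLast m (F k.castSucc) = 0) (hl : F (Fin.last n) = X (Fin.last m))
    (p : MvPolynomial (Fin (n + 1)) ℂ) :
    coeffLast m (aeval F p) = aeval G (coeffLast n p) := by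
  have he := evalLast_aeval h (by rw [hl, evalLast_X_last])
  induction p using MvPolynomial.induction_on with
  | C r => simp [algebraMap_eq]
  | add p q hp hq => simp only [map_add, hp, hq]
  | mul_X p i hp =>
    refine Fin.lastCases ?_ (fun i => ?_) i <;> simp [-aeval_eq_bind₁, hp, h, h', hl, he]

end Substitution

lemma SVskip_castSucc_last {q : ℕ} (i : Fin (q + 1)) (k : Fin q) :
    SVskip i.castSucc (Fin.last (q + 1)) k = (i.succAbove k).castSucc := by
  rw [SVskip, Fin.succAbove_last]
  congr 2
  exact Fin.ext (min_eq_left (Nat.lt_succ_iff.mp i.isLt))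

lemma SVskip_castSucc_castSucc_last {q : ℕ} {i j : Fin (q + 2)} (h : (i : ℕ) < j) :
    SVskip i.castSucc j.castSucc (Fin.last q) = Fin.last (q + 2) := by
  apply Fin.ext
  have := j.isLt
  simp only [SVskip, Fin.succAbove, Fin.lt_def, Fin.val_castSucc]
  split_ifs <;> simp only [Fin.val_castSucc, Fin.val_succ, Fin.val_last] at * <;> omega

lemma SVskip_castSucc_castSucc_castSucc {q : ℕ} {i j : Fin (q + 2)} (h : (i : ℕ) < j)
    (k : Fin q) :
    SVskip i.castSucc j.castSucc k.castSucc = (SVskip i j k).castSucc := by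
  apply Fin.ext
  have := j.isLt
  have := k.isLt
  simp only [SVskip, Fin.succAbove, Fin.lt_def, Fin.val_castSucc]
  split_ifs <;> simp only [Fin.val_castSucc, Fin.val_succ] at * <;> omega

lemma SVbrk_L (a : SVGen) :
    (SVbrk a L).1 = a ∧ (SVbrk a L).2.1 = SVweight a ∧
      (SVbrk a L).2.2 = SVweight a + 1 := by
  cases a <;> norm_num [SVbrk, SVweight]

lemma coeffLast_SVdTerm_castSucc {q : ℕ} (γ : SVRaw (q + 2)) (a : Fin (q + 2) → SVGen)
    {i j : Fin (q + 2)} (h : (i : ℕ) < j) :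
    coeffLast (q + 2) (SVdTerm γ (Fin.snoc a L) i.castSucc j.castSucc) =
      (-1 : ℂ) ^ (q + 1) • SVdTerm (SVtau γ) a i j := by
  have harg : ∀ x : SVGen, (Fin.cons x fun k => (Fin.snoc a L : Fin (q + 3) → SVGen)
      (SVskip i.castSucc j.castSucc k) : Fin (q + 2) → SVGen) =
      Fin.snoc (Fin.cons x fun k => a (SVskip i j k) : Fin (q + 1) → SVGen) L := by
    intro x
    rw [← Fin.cons_snoc_eq_snoc_cons]
    congr 1
    funext k
    refine Fin.lastCases ?_ (fun k => ?_) k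
    · simp [SVskip_castSucc_castSucc_last h]
    · simp [SVskip_castSucc_castSucc_castSucc h]
  have hsub : ∀ p, coeffLast (q + 2) (aeval (Fin.cons (X i.castSucc + X j.castSucc) fun k =>
      X (SVskip i.castSucc j.castSucc k) : Fin (q + 2) → MvPolynomial (Fin (q + 3)) ℂ) p) =
      aeval (Fin.cons (X i + X j) fun k => X (SVskip i j k) :
        Fin (q + 1) → MvPolynomial (Fin (q + 2)) ℂ) (coeffLast (q + 1) p) := by
    refine coeffLast_aeval (fun k => ?_) (fun k => ?_) ?_
    · refine Fin.cases ?_ (fun k => ?_) k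
      · simp
      · rw [Fin.castSucc_succ, Fin.cons_succ, SVskip_castSucc_castSucc_castSucc h]
        simp
    · refine Fin.cases ?_ (fun k => ?_) k
      · simp
      · rw [Fin.castSucc_succ, Fin.cons_succ, SVskip_castSucc_castSucc_castSucc h]
        simp
    · rw [← Fin.succ_last, Fin.cons_succ, SVskip_castSucc_castSucc_last h]
  simp only [SVdTerm, SVtau_apply, Fin.snoc_castSucc, Fin.val_castSucc, harg, map_smul,
    coeffLast_mul, hsub, map_sub, map_add, coeffLast_X_castSucc, coeffLast_C, evalLast_C,
    evalLast_X_castSucc]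
  rw [mul_smul_comm, smul_comm, smul_smul ((-1 : ℂ) ^ (q + 1)) ((-1 : ℂ) ^ (q + 1)), ← mul_pow]
  simp

/-- At `λ = 0`, the substitution `λ₁ ↦ λᵢ + λ` is the cyclic permutation moving `i` to the
first place. -/
lemma evalLast_aeval_cons {q : ℕ} (i : Fin (q + 1)) (p : MvPolynomial (Fin (q + 1)) ℂ) :
    evalLast (q + 1) (aeval (Fin.cons (X i.castSucc + X (Fin.last (q + 1))) fun k =>
      X (i.succAbove k).castSucc : Fin (q + 1) → MvPolynomial (Fin (q + 2)) ℂ) p) =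
      rename i.cycleRange.symm p := by
  induction p using MvPolynomial.induction_on with
  | C r => simp [algebraMap_eq]
  | add p q hp hq => simp only [map_add, hp, hq]
  | mul_X p j hp => refine Fin.cases ?_ (fun j => ?_) j <;> simp [-aeval_eq_bind₁, hp]

lemma coeffLast_aeval_cons {q : ℕ} (i : Fin (q + 1)) (p : MvPolynomial (Fin (q + 1)) ℂ) :
    coeffLast (q + 1) (aeval (Fin.cons (X i.castSucc + X (Fin.last (q + 1))) fun k =>
      X (i.succAbove k).castSucc : Fin (q + 1) → MvPolynomial (Fin (q + 2)) ℂ) p) =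
      pderiv i (rename i.cycleRange.symm p) := by
  have h0 : pderiv i (rename i.cycleRange.symm p) = rename i.cycleRange.symm (pderiv 0 p) := by
    rw [← pderiv_rename i.cycleRange.symm.injective, Fin.cycleRange_symm_zero]
  rw [h0]
  clear h0
  induction p using MvPolynomial.induction_on with
  | C r => simp [algebraMap_eq]
  | add p q hp hq => simp only [map_add, hp, hq]
  | mul_X p j hp =>
    refine Fin.cases ?_ (fun j => ?_) j <;>
      simp [-aeval_eq_bind₁, hp, evalLast_aeval_cons, add_comm, mul_comm]

lemma coeffLast_SVdTerm_last {q : ℕ} {γ : SVRaw (q + 1)} (hγ : γ ∈ SVCochain (q + 1))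
    (a : Fin (q + 1) → SVGen) (i : Fin (q + 1)) :
    coeffLast (q + 1) (SVdTerm γ (Fin.snoc a L) i.castSucc (Fin.last (q + 1))) =
      (-1 : ℂ) ^ (q + 1) • (X i * pderiv i (γ a) - SVweight (a i) • γ a) := by
  have harg : (Fin.cons (a i) fun k => a (i.succAbove k) : Fin (q + 1) → SVGen) =
      a ∘ i.cycleRange.symm := by
    funext k
    refine Fin.cases ?_ (fun k => ?_) k <;> simp
  have hs := hγ i.cycleRange.symm a
  rw [Equiv.Perm.sign_symm, Fin.sign_cycleRange] at hs
  have hsign : (((-1 : ℤˣ) ^ (i : ℕ) : ℤˣ) : ℤ) = (-1) ^ (i : ℕ) := by simp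
  obtain ⟨h₁, h₂, h₃⟩ := SVbrk_L (a i)
  have hone : (-1 : ℂ) ^ (i : ℕ) * (-1 : ℂ) ^ (i : ℕ) = 1 := by rw [← mul_pow]; simp
  simp only [SVdTerm, Fin.snoc_castSucc, Fin.snoc_last, h₁, h₂, h₃, harg, map_smul, coeffLast_mul,
    SVskip_castSucc_last, evalLast_aeval_cons, coeffLast_aeval_cons, hs, hsign, map_sub, map_add,
    coeffLast_X_castSucc, coeffLast_X_last, coeffLast_C, evalLast_C, evalLast_X_castSucc,
    evalLast_X_last, map_mul, Fin.val_castSucc, Fin.val_last, pow_add, Derivation.map_smul]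
  push_cast
  rw [mul_smul_comm, mul_smul_comm, ← smul_add, smul_smul, mul_right_comm, hone, one_mul]
  congr 1
  simp only [smul_eq_C_mul]
  simp
  ring

lemma SVd_SVtau_add_SVtau_SVd {q : ℕ} {γ : SVRaw (q + 1)} (hγ : γ ∈ SVCochain (q + 1)) :
    SVd (SVtau γ) + SVtau (SVd γ) = SVeuler (q + 1) γ := by
  funext a
  have hlast : ∑ i : Fin (q + 1),
      coeffLast (q + 1) (SVdTerm γ (Fin.snoc a L) i.castSucc (Fin.last (q + 1))) =
      (-1 : ℂ) ^ (q + 1) • SVeuler (q + 1) γ a := by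
    rw [SVeuler_apply, eulerDerivation_eq_sum, Finset.sum_smul, ← Finset.sum_sub_distrib,
      Finset.smul_sum]
    exact Finset.sum_congr rfl fun i _ => coeffLast_SVdTerm_last hγ a i
  have hinner : ∑ i : Fin (q + 1), ∑ j : Fin (q + 1), (if (i : ℕ) < j then
      coeffLast (q + 1) (SVdTerm γ (Fin.snoc a L) i.castSucc j.castSucc) else 0) =
      (-1 : ℂ) ^ q • SVd (SVtau γ) a := by
    cases q with
    | zero => simp [SVd]
    | succ q =>
      simp only [SVd, Finset.smul_sum]
      refine Finset.sum_congr rfl fun i _ => Finset.sum_congr rfl fun j _ => ?_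
      split_ifs with h
      · exact coeffLast_SVdTerm_castSucc γ a h
      · simp
  have htau : SVtau (SVd γ) a = (-1 : ℂ) ^ (q + 1) •
      ((-1 : ℂ) ^ q • SVd (SVtau γ) a + (-1 : ℂ) ^ (q + 1) • SVeuler (q + 1) γ a) := by
    rw [← hinner, ← hlast, SVtau_apply, ← Finset.sum_add_distrib]
    simp only [SVd, map_sum, apply_ite (coeffLast (q + 1)), map_zero]
    rw [Fin.sum_univ_castSucc]
    simp only [Fin.sum_univ_castSucc (n := q + 1), Fin.val_castSucc, Fin.val_last, Fin.is_lt,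
      if_true, lt_irrefl, if_false, (Fin.is_lt _).not_gt, Finset.sum_const_zero, add_zero]
  have hone : (-1 : ℂ) ^ q * (-1 : ℂ) ^ q = 1 := by rw [← mul_pow]; simp
  rw [Pi.add_apply, htau, smul_add, smul_smul, smul_smul]
  simp [pow_succ, hone]

/-- The extension of a permutation of `Fin q` to `Fin (q + 1)` fixing the last element. -/
def permSnoc {q : ℕ} (σ : Equiv.Perm (Fin q)) : Equiv.Perm (Fin (q + 1)) :=
  finSuccEquivLast.symm.permCongr σ.optionCongr

@[simp] lemma permSnoc_castSucc {q : ℕ} (σ : Equiv.Perm (Fin q)) (i : Fin q) :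
    permSnoc σ i.castSucc = (σ i).castSucc := by
  simp [permSnoc, Equiv.permCongr_apply]

@[simp] lemma permSnoc_last {q : ℕ} (σ : Equiv.Perm (Fin q)) :
    permSnoc σ (Fin.last q) = Fin.last q := by
  simp [permSnoc, Equiv.permCongr_apply]

lemma sign_permSnoc {q : ℕ} (σ : Equiv.Perm (Fin q)) :
    Equiv.Perm.sign (permSnoc σ) = Equiv.Perm.sign σ := by
  rw [permSnoc, Equiv.Perm.sign_permCongr, Equiv.optionCongr_sign]

lemma SVtau_mem_SVCochain {q : ℕ} {c : SVRaw (q + 1)} (hc : c ∈ SVCochain (q + 1)) :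
    SVtau c ∈ SVCochain q := by
  intro σ a
  have harg : (Fin.snoc (a ∘ σ) L : Fin (q + 1) → SVGen) = Fin.snoc a L ∘ permSnoc σ := by
    funext k
    refine Fin.lastCases ?_ (fun k => ?_) k <;> simp
  have hren : ∀ p, coeffLast q (rename (permSnoc σ) p) = rename σ (coeffLast q p) := by
    intro p
    rw [rename_eq_aeval, rename_eq_aeval]
    exact coeffLast_aeval (by simp) (by simp) (by simp) p
  rw [SVtau_apply, SVtau_apply, map_smul, harg, ← hren, hc, map_smul, sign_permSnoc, smul_comm]

/-- The position of a generator in the order `L, Y, M`. -/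
def SVrank : SVGen → ℕ
  | L => 0
  | Y => 1
  | M => 2

lemma exists_comp_eq_SVtuple {q : ℕ} (a : Fin q → SVGen) :
    ∃ (σ : Equiv.Perm (Fin q)) (k l m : ℕ), k + l + m = q ∧ a ∘ σ = SVtuple q k l := by
  set f : Fin q → ℕ := SVrank ∘ a
  set σ := Tuple.sort f
  have hmono : Monotone (f ∘ σ) := Tuple.monotone_sort f
  have h0 := fun j : Fin q => Tuple.lt_card_le_iff_apply_le_of_monotone (j := j) (a := 0) hmono
  have h1 := fun j : Fin q => Tuple.lt_card_le_iff_apply_le_of_monotone (j := j) (a := 1) hmono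
  set k := (Finset.univ.filter fun i => (f ∘ σ) i ≤ 0).card
  set s := (Finset.univ.filter fun i => (f ∘ σ) i ≤ 1).card
  have hks : k ≤ s := Finset.card_le_card fun i => by
    simp only [Finset.mem_filter, Finset.mem_univ, true_and]
    omega
  have hsq : s ≤ q := (Finset.card_le_univ _).trans_eq (Fintype.card_fin q)
  refine ⟨σ, k, s - k, q - s, by omega, ?_⟩
  funext j
  have hj0 := h0 j
  have hj1 := h1 j
  rw [SVtuple, Nat.add_sub_cancel' hks]
  simp only [hj0, hj1]
  simp only [f, Function.comp_apply]
  split_ifs with h₀ h₁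
  · revert h₀
    cases a (σ j) <;> simp [SVrank]
  · revert h₀ h₁
    cases a (σ j) <;> simp [SVrank]
  · revert h₀ h₁
    cases a (σ j) <;> simp [SVrank]

lemma sum_SVweight_SVtuple {q k l m : ℕ} (h : k + l + m = q) :
    ∑ i, SVweight (SVtuple q k l i) = (k : ℂ) + (l : ℂ) / 2 := by
  subst h
  rw [Fin.sum_univ_add, Fin.sum_univ_add]
  simp [SVtuple, SVweight, div_eq_mul_inv, add_assoc]

lemma exists_isHomogeneous_of_SVtuple {q : ℕ} {γ : SVRaw q} (hγ : γ ∈ SVCochain q)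
    (h : ∀ k l m : ℕ, k + l + m = q → ∃ n : ℕ, (γ (SVtuple q k l)).IsHomogeneous n ∧
      (n : ℂ) ≠ (k : ℂ) + (l : ℂ) / 2) (a : Fin q → SVGen) :
    ∃ n : ℕ, (γ a).IsHomogeneous n ∧ (n : ℂ) - ∑ i, SVweight (a i) ≠ 0 := by
  obtain ⟨σ, k, l, m, hq, hσ⟩ := exists_comp_eq_SVtuple a
  obtain ⟨n, hn, hne⟩ := h k l m hq
  refine ⟨n, ?_, ?_⟩
  · have hs := hγ σ a
    rw [hσ] at hs
    have hu : γ a = ((Equiv.Perm.sign σ : ℤ) : ℂ) • rename σ (γ (SVtuple q k l)) := by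
      rw [hs, smul_smul, ← Int.cast_mul, ← Units.val_mul, Int.units_mul_self]
      simp
    rw [hu]
    exact (homogeneousSubmodule _ ℂ n).smul_mem _ hn.rename_isHomogeneous
  · rwa [sub_ne_zero, ← Equiv.sum_comp σ, ← sum_SVweight_SVtuple hq, ← hσ] at *

lemma aeval_SVeuler_apply {q n : ℕ} {c : SVRaw q} {a : Fin q → SVGen}
    (h : (c a).IsHomogeneous n) (r : Polynomial ℂ) :
    (Polynomial.aeval (SVeuler q) r c) a = r.eval ((n : ℂ) - ∑ i, SVweight (a i)) • c a := by
  have hpow : ∀ k : ℕ, ((SVeuler q ^ k) c) a = ((n : ℂ) - ∑ i, SVweight (a i)) ^ k • c a := by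
    intro k
    induction k with
    | zero => simp
    | succ k ih =>
      have hk : (((SVeuler q ^ k) c) a).IsHomogeneous n := by
        rw [ih]
        exact (homogeneousSubmodule _ ℂ n).smul_mem _ h
      rw [pow_succ', Module.End.mul_apply, SVeuler_apply_of_isHomogeneous hk, ih, smul_smul,
        pow_succ']
  induction r using Polynomial.induction_on' with
  | add p r hp hr => simp [hp, hr, add_smul]
  | monomial k z => simp [Polynomial.aeval_monomial, hpow, mul_smul]

/-- A cocycle on whose components the degree operator acts by nonzero scalars is the image under
the degree operator of another cocycle. -/
lemma exists_mem_SVcocycles_SVeuler_eq {q : ℕ} {γ : SVRaw q} (hγ : γ ∈ SVcocycles q)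
    (h : ∀ a, ∃ n : ℕ, (γ a).IsHomogeneous n ∧ (n : ℂ) - ∑ i, SVweight (a i) ≠ 0) :
    ∃ γ' ∈ SVcocycles q, SVeuler q γ' = γ := by
  classical
  choose n hn hne using h
  let s : (Fin q → SVGen) → ℂ := fun a => (n a : ℂ) - ∑ i, SVweight (a i)
  have hfin : Finite SVGen := Finite.of_surjective (![L, Y, M] : Fin 3 → SVGen) fun x => by
    cases x
    exacts [⟨0, rfl⟩, ⟨1, rfl⟩, ⟨2, rfl⟩]
  let S : Finset ℂ := (Set.finite_range s).toFinset
  let r : Polynomial ℂ := Lagrange.interpolate S id fun z => z⁻¹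
  have hr : ∀ a, r.eval (s a) = (s a)⁻¹ := fun a =>
    Lagrange.eval_interpolate_at_node (v := id) (fun z => z⁻¹) (Set.injOn_id _)
      ((Set.finite_range s).mem_toFinset.mpr ⟨a, rfl⟩)
  have happ : ∀ a, Polynomial.aeval (SVeuler q) r γ a = (s a)⁻¹ • γ a := fun a => by
    rw [aeval_SVeuler_apply (hn a), hr]
  refine ⟨Polynomial.aeval (SVeuler q) r γ, Polynomial.aeval_apply_smul_mem_of_le_comap hγ r
    (SVeuler q) (SVcocycles_le_comap_SVeuler q), funext fun a => ?_⟩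
  have hhom : (Polynomial.aeval (SVeuler q) r γ a).IsHomogeneous (n a) := by
    rw [happ]
    exact (homogeneousSubmodule _ ℂ _).smul_mem _ (hn a)
  rw [SVeuler_apply_of_isHomogeneous hhom, happ, smul_smul, mul_inv_cancel₀ (hne a), one_smul]

/-- The homotopy identity for the operator `τ`: on a
`(k,l,m)`-component which is homogeneous of total degree `n`, one has
`(dτ + τd)γ = (n - k - l/2)·γ`.  Consequently a cocycle all of whose components
are homogeneous of degree `≠ k + l/2` is a coboundary. -/
theorem statement2 :
    (∀ (q k l m : ℕ), k + l + m = q + 1 →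
      ∀ γ : SVRaw (q + 1), γ ∈ SVCochain (q + 1) →
      ∀ n : ℕ, (γ (SVtuple (q + 1) k l)).IsHomogeneous n →
        (SVd (SVtau γ) + SVtau (SVd γ)) (SVtuple (q + 1) k l) =
          ((n : ℂ) - (k : ℂ) - (l : ℂ) / 2) • γ (SVtuple (q + 1) k l)) ∧
    (∀ (q : ℕ) (γ : SVRaw (q + 1)), γ ∈ SVcocycles (q + 1) →
      (∀ k l m : ℕ, k + l + m = q + 1 →
        ∃ n : ℕ, (γ (SVtuple (q + 1) k l)).IsHomogeneous n ∧
          (n : ℂ) ≠ (k : ℂ) + (l : ℂ) / 2) →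
      γ ∈ SVcoboundaries (q + 1)) := by
  refine ⟨fun q k l m hq γ hγ n hn => ?_, fun q γ hγ h => ?_⟩
  · rw [SVd_SVtau_add_SVtau_SVd hγ, SVeuler_apply_of_isHomogeneous hn, sum_SVweight_SVtuple hq,
      sub_sub]
  · obtain ⟨γ', ⟨hc, hd⟩, hγ'⟩ :=
      exists_mem_SVcocycles_SVeuler_eq hγ (exists_isHomogeneous_of_SVtuple hγ.1 h)
    have hd' : SVd γ' = 0 := hd
    refine ⟨SVtau γ', SVtau_mem_SVCochain hc, ?_⟩
    have htau : SVtau (0 : SVRaw (q + 2)) = 0 := by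
      funext a
      simp [SVtau]
    rw [← hγ', ← SVd_SVtau_add_SVtau_SVd hc, hd', htau, add_zero]
    rfl

end SVCA
end

section
/- For every q ≥ 7, the basic cohomology of the Schrödinger-Virasoro conformal algebra with trivial coefficients vanishes: H̃^q(SV,ℂ) = 0. -/
/-!
Cochain complex of the Schrödinger–Virasoro conformal algebra
`SV = ℂ[∂]L ⊕ ℂ[∂]Y ⊕ ℂ[∂]M` with coefficients in the trivial module `ℂ_a`.

Since `SV` is a free `ℂ[∂]`-module on the generators `L, Y, M`, and since a
`q`-cochain (a `ℂ`-linear, conformally antilinear map `SV^{⊗q} → ℂ[λ₁,…,λ_q]`)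
is uniquely determined by its values on `q`-tuples of generators, we model
cochains as functions from generator tuples to `ℂ[λ₁,…,λ_q]`, subject to the
skew-symmetry condition (simultaneous permutation of the entries and the
variables `λᵢ`).
-/

namespace SVCA

open MvPolynomial

open SVGen

section DegreeScale

variable {σ τ : Type*}

/-- Multiplication of the degree `d` component of a polynomial by `f d`, for every `d`. -/
noncomputable def degreeScale (f : ℕ → ℂ) : MvPolynomial σ ℂ →ₗ[ℂ] MvPolynomial σ ℂ :=
  (basisMonomials σ ℂ).constr ℂ fun s => monomial s (f s.degree)

lemma degreeScale_monomial (f : ℕ → ℂ) (s : σ →₀ ℕ) (r : ℂ) :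
    degreeScale f (monomial s r) = f s.degree • monomial s r := by
  have h : degreeScale f (monomial s 1) = monomial s (f s.degree) := by
    simpa [degreeScale] using
      (basisMonomials σ ℂ).constr_basis ℂ (fun s => monomial s (f s.degree)) s
  have hr : monomial s r = r • monomial s (1 : ℂ) := by simp [smul_monomial]
  rw [hr, map_smul, h]
  simp [smul_monomial, mul_comm]

lemma coeff_degreeScale (f : ℕ → ℂ) (p : MvPolynomial σ ℂ) (s : σ →₀ ℕ) :
    coeff s (degreeScale f p) = f s.degree * coeff s p := by
  classical
  induction p using MvPolynomial.induction_on' with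
  | monomial u r =>
    rw [degreeScale_monomial, coeff_smul, coeff_monomial, smul_eq_mul]
    split_ifs with h <;> simp [h]
  | add p q hp hq => rw [map_add, coeff_add, coeff_add, hp, hq, mul_add]

lemma _root_.MvPolynomial.IsHomogeneous.degreeScale_eq {p : MvPolynomial σ ℂ} {n : ℕ}
    (hp : p.IsHomogeneous n) (f : ℕ → ℂ) : degreeScale f p = f n • p := by
  ext s
  rw [coeff_degreeScale, coeff_smul, smul_eq_mul]
  by_cases h : s.degree = n
  · rw [h]
  · rw [hp.coeff_eq_zero h, mul_zero, mul_zero]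

lemma degreeScale_comm (T : MvPolynomial σ ℂ →ₗ[ℂ] MvPolynomial τ ℂ) {k : ℕ}
    (hT : ∀ s, (T (monomial s 1)).IsHomogeneous (s.degree + k)) {f g : ℕ → ℂ}
    (hfg : ∀ d, g (d + k) = f d) (p : MvPolynomial σ ℂ) :
    degreeScale g (T p) = T (degreeScale f p) := by
  have h : degreeScale g ∘ₗ T = T ∘ₗ degreeScale f := by
    refine (basisMonomials σ ℂ).ext fun s => ?_
    simp [(hT s).degreeScale_eq, degreeScale_monomial, hfg]
  exact LinearMap.congr_fun h p

lemma degreeScale_rename (f : ℕ → ℂ) (φ : σ → τ) (p : MvPolynomial σ ℂ) :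
    degreeScale f (rename φ p) = rename φ (degreeScale f p) :=
  degreeScale_comm (rename φ).toLinearMap (k := 0)
    (fun _ => (isHomogeneous_monomial _ rfl).rename_isHomogeneous) (fun _ => rfl) p

lemma sum_X_mul_pderiv_monomial [Fintype σ] (s : σ →₀ ℕ) (r : ℂ) :
    ∑ i, X i * pderiv i (monomial s r) = (s.degree : ℂ) • monomial s r := by
  rw [(isHomogeneous_monomial r rfl).sum_X_mul_pderiv, Nat.cast_smul_eq_nsmul]

/-- The Euler operator shifted by `κ` undoes scaling by `(d - κ)⁻¹` in degree `d`. -/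
lemma euler_degreeScale [Fintype σ] {κ : ℂ} {f : ℕ → ℂ} {p : MvPolynomial σ ℂ}
    (h : ∀ s ∈ p.support, f s.degree * (s.degree - κ) = 1) :
    ∑ i, X i * pderiv i (degreeScale f p) - κ • degreeScale f p = p := by
  let E : MvPolynomial σ ℂ →ₗ[ℂ] MvPolynomial σ ℂ :=
    (∑ i, LinearMap.mulLeft ℂ (X i) ∘ₗ (pderiv i).toLinearMap - κ • LinearMap.id) ∘ₗ degreeScale f
  have hE : ∀ p, E p = ∑ i, X i * pderiv i (degreeScale f p) - κ • degreeScale f p := fun p => by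
    simp [E, LinearMap.sum_apply]
  rw [← hE]
  conv_lhs => rw [p.as_sum]
  conv_rhs => rw [p.as_sum]
  rw [map_sum]
  refine Finset.sum_congr rfl fun s hs => ?_
  rw [hE, degreeScale_monomial]
  simp only [Derivation.map_smul, mul_smul_comm]
  rw [← Finset.smul_sum, sum_X_mul_pderiv_monomial, smul_comm κ, ← smul_sub, ← sub_smul, smul_smul,
    h s hs, one_smul]

end DegreeScale

section Weight

/-- The degree of a generator in the grading of `SV` with `L`, `Y`, `M` in degrees `0`, `1`, `2`. -/
def SVGen.deg : SVGen → ℕ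
  | L => 0
  | Y => 1
  | M => 2

/-- Twice the `L₀`-weight of the pairing of a cochain slot with `(a, λ^e)`. -/
def slotWeight (x : SVGen × ℕ) : ℤ := 2 * x.2 + x.1.deg - 2

lemma slotWeight_sum_pos (S : Finset (SVGen × ℕ)) (hS : 7 ≤ S.card) :
    0 < ∑ x ∈ S, slotWeight x := by
  let T : Finset (SVGen × ℕ) := {(L, 0), (L, 1), (Y, 0), (Y, 1), (M, 0)}
  have hT : ∑ x ∈ T, (slotWeight x - 2) = -12 := by decide
  have hout : ∀ x ∉ T, 0 ≤ slotWeight x - 2 := by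
    rintro ⟨g, e⟩ hx
    simp only [T, Finset.mem_insert, Finset.mem_singleton, Prod.mk.injEq, not_or] at hx
    cases g <;> simp [slotWeight, SVGen.deg] at hx ⊢ <;> omega
  have hin : ∀ x ∈ T, slotWeight x - 2 ≤ 0 := by decide
  have h1 : ∑ x ∈ T, (slotWeight x - 2) ≤ ∑ x ∈ S ∩ T, (slotWeight x - 2) :=
    Finset.sum_le_sum_of_subset_of_nonpos' Finset.inter_subset_right fun x hx _ => hin x hx
  have h2 : ∑ x ∈ S ∩ T, (slotWeight x - 2) ≤ ∑ x ∈ S, (slotWeight x - 2) :=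
    Finset.sum_le_sum_of_subset_of_nonneg Finset.inter_subset_left fun x hx hx' =>
      hout x fun h => hx' (Finset.mem_inter.2 ⟨hx, h⟩)
  have h3 : ∑ x ∈ S, (slotWeight x - 2) = ∑ x ∈ S, slotWeight x - 2 * S.card := by
    simp [Finset.sum_sub_distrib, mul_comm]
  have h4 : (7 : ℤ) ≤ S.card := by exact_mod_cast hS
  linarith

lemma injective_of_mem_support {q : ℕ} {c : SVRaw q} (hc : c ∈ SVCochain q) (a : Fin q → SVGen)
    {s : Fin q →₀ ℕ} (hs : s ∈ (c a).support) : Function.Injective fun i => (a i, s i) := by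
  intro i j hij
  by_contra hne
  simp only [Prod.mk.injEq] at hij
  have ha : a ∘ Equiv.swap i j = a := by
    funext k
    simp only [Function.comp_apply, Equiv.swap_apply_def]
    split_ifs with h h <;> simp [h, hij.1]
  have hsw : s.mapDomain (Equiv.swap i j) = s := by
    ext k
    rw [Finsupp.mapDomain_equiv_apply, Equiv.symm_swap, Equiv.swap_apply_def]
    split_ifs with h h <;> simp [h, hij.2]
  have h := congrArg (coeff s) (hc (Equiv.swap i j) a)
  rw [ha, Equiv.Perm.sign_swap hne] at h
  nth_rw 1 [← hsw] at h
  rw [coeff_rename_mapDomain _ (Equiv.injective _), coeff_smul] at h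
  simp only [Units.val_neg, Units.val_one, Int.cast_neg, Int.cast_one, smul_eq_mul, neg_mul,
    one_mul] at h
  exact mem_support_iff.1 hs (self_eq_neg.1 h)

lemma degree_ne_of_mem_support {q : ℕ} (hq : 7 ≤ q) {c : SVRaw q} (hc : c ∈ SVCochain q)
    (a : Fin q → SVGen) {s : Fin q →₀ ℕ} (hs : s ∈ (c a).support) :
    2 * s.degree + ∑ i, (a i).deg ≠ 2 * q := by
  intro h
  have hinj := injective_of_mem_support hc a hs
  have hpos := slotWeight_sum_pos (Finset.univ.image fun i => (a i, s i))
    (by rw [Finset.card_image_of_injective _ hinj]; simpa using hq)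
  rw [Finset.sum_image hinj.injOn] at hpos
  have hsum : ∑ i, slotWeight (a i, s i) = 2 * s.degree + (∑ i, (a i).deg : ℕ) - 2 * q := by
    rw [Finsupp.degree_eq_sum]
    simp [slotWeight, Finset.sum_add_distrib, Finset.mul_sum, mul_comm]
  rw [hsum] at hpos
  have : (2 * s.degree + (∑ i, (a i).deg : ℕ) : ℤ) = 2 * q := by exact_mod_cast h
  linarith

end Weight

section Homogeneity

lemma SVskip_of_lt {q : ℕ} {i j : Fin (q + 2)} (h : (i : ℕ) < j) :
    ∃ i' : Fin (q + 1), j.succAbove i' = i ∧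
      ∀ k, SVskip i j k = j.succAbove (i'.succAbove k) := by
  have hi : (i : ℕ) < q + 1 := by omega
  refine ⟨⟨i, hi⟩, ?_, fun k => ?_⟩
  · rw [Fin.succAbove_of_castSucc_lt _ ⟨i, hi⟩ (Fin.lt_def.2 h)]
    rfl
  · simp only [SVskip, min_eq_left (Nat.le_of_lt_succ hi)]

lemma SVskip_zero_succ {q : ℕ} (j : Fin (q + 1)) (k : Fin q) :
    SVskip 0 j.succ k = (j.succAbove k).succ := by
  have h0 : (⟨min ((0 : Fin (q + 2)) : ℕ) q, Nat.lt_succ_of_le (Nat.min_le_right _ _)⟩ :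
      Fin (q + 1)) = 0 := by ext; simp
  rw [SVskip, h0, Fin.zero_succAbove, Fin.succ_succAbove_succ]

lemma SVskip_succ_succ {q : ℕ} (i j : Fin (q + 2)) (k : Fin (q + 1)) :
    SVskip i.succ j.succ k = (Fin.cons 0 fun k => (SVskip i j k).succ : Fin (q + 1) → _) k := by
  have hi : (⟨min (i.succ : ℕ) (q + 1), Nat.lt_succ_of_le (Nat.min_le_right _ _)⟩ :
      Fin (q + 2)) =
      (⟨min (i : ℕ) q, Nat.lt_succ_of_le (Nat.min_le_right _ _)⟩ : Fin (q + 1)).succ := by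
    ext; simp
  rw [SVskip, hi]
  refine Fin.cases ?_ (fun k => ?_) k
  · simp
  · simp only [Fin.succ_succAbove_succ, Fin.cons_succ, SVskip]

lemma sum_SVskip {q : ℕ} {i j : Fin (q + 2)} (h : (i : ℕ) < j) (f : Fin (q + 2) → ℕ) :
    f i + f j + ∑ k, f (SVskip i j k) = ∑ k, f k := by
  obtain ⟨i', hi', hk⟩ := SVskip_of_lt h
  rw [Fin.sum_univ_succAbove f j, Fin.sum_univ_succAbove _ i', hi']
  simp only [hk]
  ring

/-- The linear form `c₂ λᵢ - c₁ (λᵢ + λⱼ)` attached to `[a_λ b] = (c₁ ∂ + c₂ λ) x`. -/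
noncomputable def brkForm {σ : Type*} (a b : SVGen) (i j : σ) : MvPolynomial σ ℂ :=
  C (SVbrk a b).2.2 * X i - C (SVbrk a b).2.1 * (X i + X j)

lemma brkForm_isHomogeneous {σ : Type*} (a b : SVGen) (i j : σ) :
    (brkForm a b i j).IsHomogeneous 1 := by
  have hC : ∀ (r : ℂ) {p : MvPolynomial σ ℂ}, p.IsHomogeneous 1 → (C r * p).IsHomogeneous 1 :=
    fun r p hp => by simpa using (isHomogeneous_C σ r).mul hp
  exact (hC _ (isHomogeneous_X _ _)).sub (hC _ ((isHomogeneous_X _ _).add (isHomogeneous_X _ _)))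

lemma brkForm_eq_zero_or_deg {σ : Type*} (a b : SVGen) :
    (∀ i j : σ, brkForm a b i j = 0) ∨ (SVbrk a b).1.deg = a.deg + b.deg := by
  cases a <;> cases b <;> simp [brkForm, SVbrk, SVGen.deg]

/-- Scaling of the bihomogeneous components of a cochain: `f n d` in polynomial degree `d` on
tuples of generators of total degree `n`. -/
noncomputable def cochainScale (f : ℕ → ℕ → ℂ) {q : ℕ} (c : SVRaw q) : SVRaw q := fun a =>
  degreeScale (f (∑ i, (a i).deg)) (c a)

lemma cochainScale_mem (f : ℕ → ℕ → ℂ) {q : ℕ} {c : SVRaw q} (hc : c ∈ SVCochain q) :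
    cochainScale f c ∈ SVCochain q := by
  intro σ a
  have hs : ∑ i, ((a ∘ σ) i).deg = ∑ i, (a i).deg := Equiv.sum_comp σ fun i => (a i).deg
  rw [cochainScale, hs, ← degreeScale_rename, hc σ a, map_smul, cochainScale]

lemma SVdTerm_cochainScale {f g : ℕ → ℕ → ℂ} (hfg : ∀ n d, g n (d + 1) = f n d) {q : ℕ}
    (c : SVRaw (q + 1)) (a : Fin (q + 2) → SVGen) {i j : Fin (q + 2)} (h : (i : ℕ) < j) :
    SVdTerm (cochainScale f c) a i j =
      degreeScale (g (∑ k, (a k).deg)) (SVdTerm c a i j) := by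
  rw [SVdTerm, SVdTerm, map_smul]
  congr 1
  change brkForm (a i) (a j) i j * _ = degreeScale _ (brkForm (a i) (a j) i j * _)
  rcases brkForm_eq_zero_or_deg (σ := Fin (q + 2)) (a i) (a j) with h0 | h0
  · simp [h0]
  · have hdeg : ∑ k, ((Fin.cons (SVbrk (a i) (a j)).1 (fun k => a (SVskip i j k)) :
        Fin (q + 1) → SVGen) k).deg = ∑ k, (a k).deg := by
      rw [Fin.sum_univ_succ]
      simp only [Fin.cons_zero, Fin.cons_succ, h0]
      exact sum_SVskip h fun k => (a k).deg
    rw [cochainScale, hdeg]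
    refine (degreeScale_comm (LinearMap.mulLeft ℂ (brkForm (a i) (a j) i j) ∘ₗ
      (aeval (Fin.cons (X i + X j) fun k => X (SVskip i j k))).toLinearMap) (k := 1)
      (fun s => ?_) (hfg _) _).symm
    have haev := (isHomogeneous_monomial (R := ℂ) 1 (rfl : s.degree = s.degree)).aeval
      (n := 1) (Fin.cons (X i + X j) fun k => X (SVskip i j k) :
        Fin (q + 1) → MvPolynomial (Fin (q + 2)) ℂ)
      (Fin.cases ((isHomogeneous_X _ _).add (isHomogeneous_X _ _)) fun k => isHomogeneous_X _ _)
    simpa [add_comm] using (brkForm_isHomogeneous (a i) (a j) i j).mul haev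

lemma SVd_cochainScale {f g : ℕ → ℕ → ℂ} (hfg : ∀ n d, g n (d + 1) = f n d) {q : ℕ}
    (c : SVRaw (q + 1)) : SVd (cochainScale f c) = cochainScale g (SVd c) := by
  funext a
  simp only [SVd, cochainScale, map_sum]
  refine Finset.sum_congr rfl fun i _ => Finset.sum_congr rfl fun j _ => ?_
  split_ifs with h
  · exact SVdTerm_cochainScale hfg c a h
  · simp

end Homogeneity

section Homotopy

/-- `p ↦ p|_{λ₀ = 0}`. -/
noncomputable def evalZero {q : ℕ} : MvPolynomial (Fin (q + 1)) ℂ →ₐ[ℂ] MvPolynomial (Fin q) ℂ :=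
  aeval (Fin.cons 0 X)

/-- `p ↦ (∂p/∂λ₀)|_{λ₀ = 0}`. -/
noncomputable def derivZero {q : ℕ} : MvPolynomial (Fin (q + 1)) ℂ →ₗ[ℂ] MvPolynomial (Fin q) ℂ :=
  evalZero.toLinearMap ∘ₗ (pderiv 0).toLinearMap

lemma derivZero_apply {q : ℕ} (p : MvPolynomial (Fin (q + 1)) ℂ) :
    derivZero p = evalZero (pderiv 0 p) := rfl

@[simp] lemma evalZero_X_zero {q : ℕ} : evalZero (X 0 : MvPolynomial (Fin (q + 1)) ℂ) = 0 := by
  simp [evalZero]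

@[simp] lemma evalZero_X_succ {q : ℕ} (k : Fin q) : evalZero (X k.succ) = X k := by
  simp [evalZero]

@[simp] lemma evalZero_C {q : ℕ} (r : ℂ) :
    evalZero (C r : MvPolynomial (Fin (q + 1)) ℂ) = C r := by
  simp [evalZero, algebraMap_eq]

lemma derivZero_mul {q : ℕ} (p r : MvPolynomial (Fin (q + 1)) ℂ) :
    derivZero (p * r) = derivZero p * evalZero r + evalZero p * derivZero r := by
  simp only [derivZero_apply, Derivation.leibniz, map_add, smul_eq_mul, map_mul]
  ring

@[simp] lemma derivZero_C {q : ℕ} (r : ℂ) :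
    derivZero (C r : MvPolynomial (Fin (q + 1)) ℂ) = 0 := by
  simp [derivZero_apply]

@[simp] lemma derivZero_X_zero {q : ℕ} : derivZero (X 0 : MvPolynomial (Fin (q + 1)) ℂ) = 1 := by
  simp [derivZero_apply]

@[simp] lemma derivZero_X_succ {q : ℕ} (k : Fin q) : derivZero (X k.succ) = 0 := by
  simp [derivZero_apply, pderiv_X_of_ne (Fin.succ_ne_zero k)]

/-- The chain rule for `derivZero` and a substitution in which exactly one variable `i` receives
a `λ₀`-linear term, with coefficient `1`. -/
lemma derivZero_aeval {m q : ℕ} (v : Fin m → MvPolynomial (Fin (q + 1)) ℂ) (i : Fin m)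
    (hv : ∀ k, derivZero (v k) = if k = i then 1 else 0) (p : MvPolynomial (Fin m) ℂ) :
    derivZero (aeval v p) = aeval (fun k => evalZero (v k)) (pderiv i p) := by
  have hev : ∀ p, evalZero (aeval v p) = aeval (fun k => evalZero (v k)) p := fun p =>
    comp_aeval_apply v evalZero p
  induction p using MvPolynomial.induction_on with
  | C r => simp [algebraMap_eq]
  | add p r hp hr => simp only [map_add, hp, hr]
  | mul_X p k hp =>
    rw [map_mul, derivZero_mul, hp, aeval_X, hev, hv, Derivation.leibniz, pderiv_X]
    by_cases h : k = i
    · subst h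
      simp
      ring
    · simp [h]
      ring

/-- The contracting homotopy
`(hγ)_{λ₁,…,λ_q}(a₁,…,a_q) = ∂/∂λ γ_{λ,λ₁,…,λ_q}(L,a₁,…,a_q)|_{λ=0}`. -/
noncomputable def homotopyL {q : ℕ} (c : SVRaw (q + 1)) : SVRaw q := fun a =>
  derivZero (c (Fin.cons L a))

lemma homotopyL_mem {q : ℕ} {c : SVRaw (q + 1)} (hc : c ∈ SVCochain (q + 1)) :
    homotopyL c ∈ SVCochain q := by
  intro σ a
  let ρ : Equiv.Perm (Fin (q + 1)) := Equiv.Perm.decomposeFin.symm (0, σ)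
  have hρ0 : ρ 0 = 0 := by simp [ρ]
  have hρs : ∀ k, ρ (Fin.succ k) = (σ k).succ := fun k => by simp [ρ]
  have hcons : (Fin.cons L a : Fin (q + 1) → SVGen) ∘ ρ = Fin.cons L (a ∘ σ) := by
    funext k
    refine Fin.cases ?_ (fun k => ?_) k <;> simp [hρ0, hρs]
  have h := hc ρ (Fin.cons L a)
  rw [hcons, Equiv.Perm.decomposeFin.symm_sign, if_pos rfl, one_mul] at h
  have hcomm : ∀ p, rename σ (derivZero p) = derivZero (rename ρ p) := fun p => by
    have hp : pderiv 0 (rename ρ p) = rename ρ (pderiv 0 p) := by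
      conv_lhs => rw [← hρ0]
      exact pderiv_rename ρ.injective 0 p
    have halg : (rename σ).comp (evalZero (q := q)) = evalZero.comp (rename ρ) := by
      refine algHom_ext fun k => ?_
      refine Fin.cases ?_ (fun k => ?_) k <;> simp [hρ0, hρs]
    rw [derivZero_apply, derivZero_apply, hp]
    exact DFunLike.congr_fun halg (pderiv 0 p)
  rw [homotopyL, hcomm, h, map_smul, homotopyL]

lemma cochain_cons_succAbove {q : ℕ} {c : SVRaw (q + 1)} (hc : c ∈ SVCochain (q + 1))
    (a : Fin (q + 1) → SVGen) (j : Fin (q + 1)) :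
    rename (Fin.cons j j.succAbove : Fin (q + 1) → Fin (q + 1))
      (c (Fin.cons (a j) fun k => a (j.succAbove k))) = (-1 : ℂ) ^ (j : ℕ) • c a ∧
    rename (Fin.cons j j.succAbove : Fin (q + 1) → Fin (q + 1))
      (pderiv 0 (c (Fin.cons (a j) fun k => a (j.succAbove k)))) =
        (-1 : ℂ) ^ (j : ℕ) • pderiv j (c a) := by
  have hσ : (j.cycleRange.symm : Fin (q + 1) → Fin (q + 1)) = Fin.cons j j.succAbove := by
    funext k
    refine Fin.cases ?_ (fun k => ?_) k <;> simp
  have ha : a ∘ j.cycleRange.symm = Fin.cons (a j) fun k => a (j.succAbove k) := by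
    funext k
    refine Fin.cases ?_ (fun k => ?_) k <;> simp
  have h := hc j.cycleRange.symm a
  rw [ha, hσ, Equiv.Perm.sign_symm, Fin.sign_cycleRange] at h
  push_cast at h
  refine ⟨h, ?_⟩
  have hinj : Function.Injective (Fin.cons j j.succAbove : Fin (q + 1) → Fin (q + 1)) :=
    hσ ▸ j.cycleRange.symm.injective
  rw [← pderiv_rename hinj, h, Fin.cons_zero, Derivation.map_smul]

lemma pderiv_one_cochain {q : ℕ} {c : SVRaw (q + 2)} (hc : c ∈ SVCochain (q + 2))
    (x y : SVGen) (b : Fin q → SVGen) :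
    pderiv 1 (c (Fin.cons x (Fin.cons y b))) =
      -rename (Equiv.swap 0 1) (pderiv 0 (c (Fin.cons y (Fin.cons x b)))) := by
  have hb : (Fin.cons x (Fin.cons y b) : Fin (q + 2) → SVGen) ∘ Equiv.swap 0 1 =
      Fin.cons y (Fin.cons x b) := by
    funext k
    refine Fin.cases ?_ (Fin.cases ?_ fun k => ?_) k
    · simp
    · simp
    · have : Equiv.swap (0 : Fin (q + 2)) 1 k.succ.succ = k.succ.succ :=
        Equiv.swap_apply_of_ne_of_ne (Fin.succ_ne_zero _) (by simp [Fin.ext_iff])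
      simp [this]
  have h := hc (Equiv.swap 0 1) (Fin.cons x (Fin.cons y b))
  rw [hb, Equiv.Perm.sign_swap (by simp)] at h
  have h' : c (Fin.cons x (Fin.cons y b)) =
      -rename (Equiv.swap 0 1) (c (Fin.cons y (Fin.cons x b))) := by
    rw [h]; simp
  rw [h', map_neg, ← pderiv_rename (Equiv.injective _), Equiv.swap_apply_left]

lemma derivZero_SVdTerm_zero {q : ℕ} {c : SVRaw (q + 1)} (hc : c ∈ SVCochain (q + 1))
    (a : Fin (q + 1) → SVGen) (j : Fin (q + 1)) :
    derivZero (SVdTerm c (Fin.cons L a) 0 j.succ) =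
      X j * pderiv j (c a) - (1 - (a j).deg / 2 : ℂ) • c a := by
  obtain ⟨h0, h1⟩ := cochain_cons_succAbove hc a j
  have hx : (SVbrk L (a j)).1 = a j := by cases a j <;> rfl
  have hvar : (fun k => evalZero ((Fin.cons (X 0 + X j.succ) fun k =>
      X (SVskip 0 j.succ k) : Fin (q + 1) → MvPolynomial (Fin (q + 2)) ℂ) k)) =
      fun k => X ((Fin.cons j j.succAbove : Fin (q + 1) → Fin (q + 1)) k) := by
    funext k
    refine Fin.cases ?_ (fun k => ?_) k <;> simp [SVskip_zero_succ]
  have hren : ∀ p : MvPolynomial (Fin (q + 1)) ℂ,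
      aeval (fun k => X ((Fin.cons j j.succAbove : Fin (q + 1) → Fin (q + 1)) k)) p =
        rename (Fin.cons j j.succAbove : Fin (q + 1) → Fin (q + 1)) p := fun p =>
    DFunLike.congr_fun (algHom_ext (f := aeval _) (g := rename _) fun k => by simp) p
  have hev : ∀ p, evalZero (aeval (Fin.cons (X 0 + X j.succ) fun k =>
      X (SVskip 0 j.succ k) : Fin (q + 1) → MvPolynomial (Fin (q + 2)) ℂ) p) =
      rename (Fin.cons j j.succAbove : Fin (q + 1) → Fin (q + 1)) p := fun p => by
    rw [← hren, ← hvar]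
    exact comp_aeval_apply _ evalZero p
  have hdv : ∀ p, derivZero (aeval (Fin.cons (X 0 + X j.succ) fun k =>
      X (SVskip 0 j.succ k) : Fin (q + 1) → MvPolynomial (Fin (q + 2)) ℂ) p) =
      rename (Fin.cons j j.succAbove : Fin (q + 1) → Fin (q + 1)) (pderiv 0 p) := fun p => by
    rw [← hren, ← hvar]
    refine derivZero_aeval _ 0 (fun k => ?_) p
    refine Fin.cases ?_ (fun k => ?_) k <;> simp [SVskip_zero_succ]
  have hlin : derivZero (brkForm L (a j) (0 : Fin (q + 2)) j.succ) =
        C (1 - (a j).deg / 2 : ℂ) ∧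
      evalZero (brkForm L (a j) (0 : Fin (q + 2)) j.succ) = -X j := by
    constructor
    · have : derivZero (brkForm L (a j) (0 : Fin (q + 2)) j.succ) =
          C ((SVbrk L (a j)).2.2 - (SVbrk L (a j)).2.1) := by
        simp [brkForm, derivZero_mul]
      rw [this]
      congr 1
      cases a j <;> norm_num [SVbrk, SVGen.deg]
    · have : (SVbrk L (a j)).2.1 = 1 := by cases a j <;> rfl
      simp [brkForm, this]
  have harg : (fun k => (Fin.cons L a : Fin (q + 2) → SVGen) (SVskip 0 j.succ k)) =
      fun k => a (j.succAbove k) := by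
    funext k
    simp [SVskip_zero_succ]
  have hsq : ((-1 : ℂ) ^ (j : ℕ)) * (-1) ^ (j : ℕ) = 1 := by
    rw [← mul_pow]; simp
  rw [SVdTerm, map_smul, Fin.cons_zero, Fin.cons_succ, harg]
  change _ • derivZero (brkForm L (a j) (0 : Fin (q + 2)) j.succ * _) = _
  rw [derivZero_mul, hlin.1, hlin.2, hev, hdv, hx, h0, h1, C_mul', neg_mul, mul_smul_comm,
    smul_comm _ ((-1 : ℂ) ^ (j : ℕ)), ← sub_eq_add_neg, ← smul_sub, smul_smul]
  rw [Fin.val_zero, Fin.val_succ, zero_add, pow_succ, mul_right_comm, hsq, one_mul, neg_one_smul,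
    neg_sub]

lemma derivZero_SVdTerm_succ {q : ℕ} {c : SVRaw (q + 2)} (hc : c ∈ SVCochain (q + 2))
    (a : Fin (q + 2) → SVGen) (i j : Fin (q + 2)) :
    derivZero (SVdTerm c (Fin.cons L a) i.succ j.succ) = -SVdTerm (homotopyL c) a i j := by
  set x := (SVbrk (a i) (a j)).1 with hx
  set v : Fin (q + 2) → MvPolynomial (Fin (q + 3)) ℂ :=
    Fin.cons (X i.succ + X j.succ) fun k => X (SVskip i.succ j.succ k) with hv
  set w : Fin (q + 1) → MvPolynomial (Fin (q + 2)) ℂ :=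
    Fin.cons (X i + X j) fun k => X (SVskip i j k) with hw
  have harg : (fun k => (Fin.cons L a : Fin (q + 3) → SVGen) (SVskip i.succ j.succ k)) =
      Fin.cons L fun k => a (SVskip i j k) := by
    funext k
    refine Fin.cases ?_ (fun k => ?_) k <;> simp [SVskip_succ_succ]
  have hlin : derivZero (brkForm (a i) (a j) i.succ j.succ) = 0 ∧
      evalZero (brkForm (a i) (a j) i.succ j.succ) = brkForm (a i) (a j) i j := by
    constructor <;> simp [brkForm, derivZero_mul]
  have hdv : ∀ p, derivZero (aeval v p) = aeval (fun k => evalZero (v k)) (pderiv 1 p) :=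
    derivZero_aeval v 1 fun k => by
      refine Fin.cases ?_ (Fin.cases ?_ fun k => ?_) k
      · simp [hv]
      · simp [hv, SVskip_succ_succ]
      · have : k.succ.succ ≠ (1 : Fin (q + 2)) := by simp [Fin.ext_iff]
        simp [hv, SVskip_succ_succ, this]
  have hvw : ∀ p, aeval (fun k => evalZero (v k)) (rename (Equiv.swap 0 1) p) =
      aeval w (evalZero p) := fun p => by
    rw [aeval_rename]
    refine Eq.trans ?_ (comp_aeval_apply _ (aeval w) p).symm
    congr 2
    funext k
    refine Fin.cases ?_ (Fin.cases ?_ fun k => ?_) k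
    · simp [hv, SVskip_succ_succ]
    · simp [hv, hw]
    · have : Equiv.swap (0 : Fin (q + 2)) 1 k.succ.succ = k.succ.succ :=
        Equiv.swap_apply_of_ne_of_ne (Fin.succ_ne_zero _) (by simp [Fin.ext_iff])
      simp [hv, hw, this, SVskip_succ_succ]
  have hpow : (-1 : ℂ) ^ ((i.succ : ℕ) + (j.succ : ℕ)) = (-1) ^ ((i : ℕ) + (j : ℕ)) := by
    rw [Fin.val_succ, Fin.val_succ, show (i : ℕ) + 1 + (j + 1) = i + j + 2 by ring, pow_add]
    simp
  rw [SVdTerm, SVdTerm, map_smul, Fin.cons_succ, Fin.cons_succ, harg, hpow, ← smul_neg]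
  congr 1
  change derivZero (brkForm (a i) (a j) i.succ j.succ * aeval v _) =
    -(brkForm (a i) (a j) i j * aeval w _)
  rw [derivZero_mul, hlin.1, hlin.2, zero_mul, zero_add, hdv, ← hx, pderiv_one_cochain hc,
    map_neg, hvw, homotopyL, derivZero_apply, mul_neg]

/-- Cartan's formula for `L₀`: `dh + hd` is the action of `L₀` on cochains. -/
lemma SVd_homotopyL_add {q : ℕ} {c : SVRaw (q + 2)} (hc : c ∈ SVCochain (q + 2))
    (a : Fin (q + 2) → SVGen) :
    SVd (homotopyL c) a + homotopyL (SVd c) a =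
      ∑ j, X j * pderiv j (c a) - ((q + 2 : ℕ) - (∑ j, (a j).deg : ℕ) / 2 : ℂ) • c a := by
  have hsum : homotopyL (SVd c) a =
      ∑ j, (X j * pderiv j (c a) - (1 - (a j).deg / 2 : ℂ) • c a) - SVd (homotopyL c) a := by
    rw [homotopyL, SVd, map_sum, Fin.sum_univ_succ, map_sum, Fin.sum_univ_succ]
    rw [sub_eq_add_neg]
    congr 1
    · simp [derivZero_SVdTerm_zero hc]
    · rw [SVd, ← Finset.sum_neg_distrib]
      refine Finset.sum_congr rfl fun i _ => ?_
      rw [map_sum, Fin.sum_univ_succ, ← Finset.sum_neg_distrib]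
      simp only [Fin.val_succ, Fin.val_zero, not_lt_zero, if_false, map_zero, zero_add,
        Nat.add_lt_add_iff_right]
      refine Finset.sum_congr rfl fun j _ => ?_
      split_ifs
      · exact derivZero_SVdTerm_succ hc a i j
      · simp
  rw [hsum, add_sub_cancel, Finset.sum_sub_distrib, ← Finset.sum_smul, Finset.sum_sub_distrib,
    ← Finset.sum_div]
  simp

end Homotopy

lemma SVcocycles_le_SVcoboundaries (q : ℕ) (hq : 7 ≤ q) : SVcocycles q ≤ SVcoboundaries q := by
  obtain ⟨q, rfl⟩ : ∃ r, q = r + 2 := ⟨q - 2, by omega⟩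
  rintro c ⟨hc, hdc⟩
  have hdc : SVd c = 0 := hdc
  let f : ℕ → ℕ → ℂ := fun n d => (d - ((q + 2 : ℕ) - n / 2))⁻¹
  have hb := cochainScale_mem f hc
  have hdb : SVd (cochainScale f c) = 0 := by
    rw [SVd_cochainScale (g := fun n d => f n (d - 1)) (by simp), hdc]
    funext a
    simp [cochainScale]
  refine ⟨homotopyL (cochainScale f c), homotopyL_mem hb, funext fun a => ?_⟩
  have h := SVd_homotopyL_add hb a
  rw [hdb] at h
  simp only [homotopyL, Pi.zero_apply, map_zero, add_zero] at h
  refine h.trans (euler_degreeScale fun s hs => inv_mul_cancel₀ fun h0 => ?_)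
  refine degree_ne_of_mem_support hq hc a hs ?_
  have : (2 * s.degree + (∑ i, (a i).deg : ℕ) : ℂ) = 2 * (q + 2 : ℕ) := by
    linear_combination 2 * h0
  exact_mod_cast this

/-- `H̃^q(SV,ℂ) = 0` for all `q ≥ 7`: every `q`-cocycle is a
`q`-coboundary, and the basic cohomology in degree `q` is trivial. -/
theorem statement4 (q : ℕ) (hq : 7 ≤ q) :
    SVcocycles q ≤ SVcoboundaries q ∧ Subsingleton (SVbasicH q) := by
  have h := SVcocycles_le_SVcoboundaries q hq
  refine ⟨h, ?_⟩
  unfold SVbasicH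
  rw [Submodule.Quotient.subsingleton_iff, Submodule.comap_subtype_eq_top]
  exact h

end SVCA
end

section
/- The first basic cohomology of the Schrödinger-Virasoro conformal algebra with trivial coefficients vanishes: H̃¹(SV,ℂ) = 0, i.e., every 1-cocycle is zero (there are no nonzero 1-cocycles). -/
/-!
Cochain complex of the Schrödinger–Virasoro conformal algebra
`SV = ℂ[∂]L ⊕ ℂ[∂]Y ⊕ ℂ[∂]M` with coefficients in the trivial module `ℂ_a`.

Since `SV` is a free `ℂ[∂]`-module on the generators `L, Y, M`, and since a
`q`-cochain (a `ℂ`-linear, conformally antilinear map `SV^{⊗q} → ℂ[λ₁,…,λ_q]`)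
is uniquely determined by its values on `q`-tuples of generators, we model
cochains as functions from generator tuples to `ℂ[λ₁,…,λ_q]`, subject to the
skew-symmetry condition (simultaneous permutation of the entries and the
variables `λᵢ`).
-/

namespace SVCA

open MvPolynomial

open SVGen

/-- A univariate polynomial that vanishes after the substitution `λ ↦ λ₀ + λ₁` is zero. -/
lemma eq_zero_of_aeval_X_add_X_eq_zero {R : Type*} [CommRing R] {p : MvPolynomial (Fin 1) R}
    {v : Fin 1 → MvPolynomial (Fin 2) R} (hv : v 0 = X 0 + X 1) (h : aeval v p = 0) : p = 0 := by
  have key : (aeval (![X 0, 0] : Fin 2 → MvPolynomial (Fin 1) R)).comp (aeval v) =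
      AlgHom.id R (MvPolynomial (Fin 1) R) := by
    ext i
    simp [Subsingleton.elim i 0, hv]
  have hp := DFunLike.congr_fun key p
  rwa [AlgHom.comp_apply, h, map_zero, AlgHom.id_apply, eq_comm] at hp

/-- If `[a_λ b] = (∂ + sλ)x`, then every `1`-cocycle vanishes on `x`. -/
lemma eq_zero_of_SVd_eq_zero {γ : SVRaw 1} (hγ : SVd γ = 0) {a b x : SVGen} {s : ℂ}
    (hab : SVbrk a b = (x, 1, s)) {t : Fin 1 → SVGen} (ht : t 0 = x) : γ t = 0 := by
  have hsum : ∑ i : Fin 2, ∑ j : Fin 2,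
      (if (i : ℕ) < (j : ℕ) then SVdTerm γ ![a, b] i j else 0) = 0 := congrFun hγ ![a, b]
  have h : SVdTerm γ ![a, b] (0 : Fin 2) 1 = 0 := by simpa [Fin.sum_univ_two] using hsum
  have hcons (u : Fin 0 → SVGen) : (Fin.cons x u : Fin (0 + 1) → SVGen) = t := by
    ext i
    rw [Fin.fin_one_eq_zero i]
    exact ht.symm
  simp only [SVdTerm, Matrix.cons_val_zero, Matrix.cons_val_one, hab, hcons] at h
  have h := (smul_eq_zero.mp h).resolve_left (pow_ne_zero _ (neg_ne_zero.mpr one_ne_zero))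
  refine eq_zero_of_aeval_X_add_X_eq_zero (Fin.cons_zero _ _)
    ((mul_eq_zero.mp h).resolve_left fun h₀ => ?_)
  simpa using congrArg (eval ![0, 1]) h₀

/-- `H̃¹(SV,ℂ) = 0`; in fact every `1`-cocycle is zero. -/
theorem statement5 :
    (∀ γ : SVRaw 1, γ ∈ SVcocycles 1 → γ = 0) ∧ Subsingleton (SVbasicH 1) := by
  have hzero : ∀ γ : SVRaw 1, γ ∈ SVcocycles 1 → γ = 0 := by
    rintro γ ⟨-, hγ⟩
    ext1 t
    cases ht : t 0 with
    | L => exact eq_zero_of_SVd_eq_zero hγ (a := L) (b := L) rfl ht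
    | Y => exact eq_zero_of_SVd_eq_zero hγ (a := L) (b := Y) rfl ht
    | M => exact eq_zero_of_SVd_eq_zero hγ (a := L) (b := M) rfl ht
  have : Subsingleton (SVcocycles 1) :=
    (Submodule.subsingleton_iff_eq_bot).mpr ((Submodule.eq_bot_iff _).mpr hzero)
  exact ⟨hzero, (Submodule.Quotient.mk_surjective _).subsingleton⟩

end SVCA
end
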